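/- Let C_ℓ = [0,ℓ]³ ⊂ ℝ³ with ℓ > 0. For every y ∈ ℝ³ and every f ∈ H¹(C_ℓ) one has 16 ∫_{C_ℓ} |∇f(x)|² dx + (144/ℓ²) ∫_{C_ℓ} |f(x)|² dx ≥ (1/4) ∫_{C_ℓ} |f(x)|²/|x−y|² dx. -/

import Mathlib

open MeasureTheory Real

noncomputable section

/-- `ℝ³`. -/
abbrev Pt := EuclideanSpace ℝ (Fin 3)

/-- The cube `[0,ℓ]³ ⊂ ℝ³`. -/
def cube (ℓ : ℝ) : Set Pt := {v : Pt | ∀ k : Fin 3, v k ∈ Set.Icc (0:ℝ) ℓ}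

/-- The divergence of a vector field on `ℝ³`. -/
def divergence (V : Pt → Pt) (x : Pt) : ℝ :=
  ∑ i, fderiv ℝ V x (EuclideanSpace.single i 1) i

theorem toLp_preimage_cube (ℓ : ℝ) :
    (WithLp.toLp 2 : (Fin 3 → ℝ) → Pt) ⁻¹' cube ℓ = Set.Icc (fun _ => 0) (fun _ => ℓ) := by
  ext u
  simp [cube, Pi.le_def, forall_and]

theorem isCompact_cube (ℓ : ℝ) : IsCompact (cube ℓ) := by
  have h : cube ℓ = Set.image (WithLp.toLp 2 : (Fin 3 → ℝ) → Pt)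
      (Set.Icc (fun _ => 0) (fun _ => ℓ)) := by
    rw [← toLp_preimage_cube, Set.image_preimage_eq _ (WithLp.toLp_surjective 2)]
  rw [h]
  exact isCompact_Icc.image (PiLp.continuous_toLp 2 _)

theorem setIntegral_cube_eq (ℓ : ℝ) (g : Pt → ℝ) :
    ∫ x in cube ℓ, g x
      = ∫ u in Set.Icc (fun _ : Fin 3 => (0 : ℝ)) (fun _ => ℓ), g (WithLp.toLp 2 u) := by
  rw [← toLp_preimage_cube]
  exact ((PiLp.volume_preserving_toLp (Fin 3)).setIntegral_preimage_emb
    (MeasurableEquiv.toLp 2 (Fin 3 → ℝ)).measurableEmbedding g (cube ℓ)).symm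

theorem ContDiffOn.continuousOn_divergence {V : Pt → Pt} {U : Set Pt} (hU : IsOpen U)
    (hV : ContDiffOn ℝ 1 V U) : ContinuousOn (divergence V) U := by
  have h : ContinuousOn (fderiv ℝ V) U := hV.continuousOn_fderiv_of_isOpen hU le_rfl
  unfold divergence
  fun_prop

/-- A vector field that does not point outwards on the boundary of the cube has nonpositive total
divergence. -/
theorem setIntegral_divergence_cube_nonpos {ℓ : ℝ} (hℓ : 0 < ℓ) {V : Pt → Pt} {U : Set Pt}
    (hU : IsOpen U) (hcU : cube ℓ ⊆ U) (hV : ContDiffOn ℝ 1 V U)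
    (hupper : ∀ x ∈ cube ℓ, ∀ i, x i = ℓ → V x i ≤ 0)
    (hlower : ∀ x ∈ cube ℓ, ∀ i, x i = 0 → 0 ≤ V x i) :
    ∫ x in cube ℓ, divergence V x ≤ 0 := by
  have hmem : ∀ u ∈ Set.Icc (fun _ : Fin 3 => (0 : ℝ)) (fun _ => ℓ),
      (WithLp.toLp 2 u : Pt) ∈ cube ℓ := fun u hu => by
    rwa [← Set.mem_preimage, toLp_preimage_cube]
  have hface : ∀ (i : Fin 3) (t : ℝ), t ∈ Set.Icc 0 ℓ → ∀ w ∈ Set.Icc (fun _ : Fin 2 => (0 : ℝ))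
      (fun _ => ℓ), (WithLp.toLp 2 (i.insertNth t w) : Pt) ∈ cube ℓ := by
    intro i t ht w hw
    refine hmem _ ?_
    rw [Fin.insertNth_mem_Icc]
    exact ⟨ht, hw⟩
  have hcont : Continuous (WithLp.toLp 2 : (Fin 3 → ℝ) → Pt) := PiLp.continuous_toLp 2 _
  rw [setIntegral_cube_eq]
  have key := integral_divergence_of_hasFDerivAt_off_countable' (n := 2)
    (fun _ => (0 : ℝ)) (fun _ => ℓ) (fun _ => hℓ.le)
    (fun i u => V (WithLp.toLp 2 u) i)
    (fun i u => (EuclideanSpace.proj i : Pt →L[ℝ] ℝ).comp ((fderiv ℝ V (WithLp.toLp 2 u)).comp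
      (PiLp.continuousLinearEquiv 2 ℝ (fun _ : Fin 3 => ℝ)).symm.toContinuousLinearMap))
    ∅ Set.countable_empty ?_ ?_ ?_
  · have hdiv : ∀ u : Fin 3 → ℝ, divergence V (WithLp.toLp 2 u) = ∑ i,
      ((EuclideanSpace.proj i : Pt →L[ℝ] ℝ).comp ((fderiv ℝ V (WithLp.toLp 2 u)).comp
      (PiLp.continuousLinearEquiv 2 ℝ (fun _ : Fin 3 => ℝ)).symm.toContinuousLinearMap))
        (Pi.single i 1) := fun u => rfl
    simp only [hdiv]
    refine key.trans_le (Finset.sum_nonpos fun i _ => ?_)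
    have h1 : ∫ w in Set.Icc (fun _ : Fin 2 => (0 : ℝ)) (fun _ => ℓ),
        V (WithLp.toLp 2 (i.insertNth ℓ w)) i ≤ 0 :=
      setIntegral_nonpos measurableSet_Icc fun w hw =>
        hupper _ (hface i ℓ ⟨hℓ.le, le_rfl⟩ w hw) i (by simp)
    have h2 : 0 ≤ ∫ w in Set.Icc (fun _ : Fin 2 => (0 : ℝ)) (fun _ => ℓ),
        V (WithLp.toLp 2 (i.insertNth 0 w)) i :=
      setIntegral_nonneg measurableSet_Icc fun w hw =>
        hlower _ (hface i 0 ⟨le_rfl, hℓ.le⟩ w hw) i (by simp)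
    exact sub_nonpos.2 (h1.trans h2)
  · intro i
    have h := hV.continuousOn.comp hcont.continuousOn (fun u hu => hcU (hmem u hu))
    exact (EuclideanSpace.proj i : Pt →L[ℝ] ℝ).continuous.comp_continuousOn h
  · rintro u ⟨hu, -⟩ i
    have hu' : (WithLp.toLp 2 u : Pt) ∈ U := hcU (hmem u
      ⟨fun i => (hu i trivial).1.le, fun i => (hu i trivial).2.le⟩)
    have hd : HasFDerivAt V (fderiv ℝ V (WithLp.toLp 2 u)) (WithLp.toLp 2 u) :=
      ((hV.differentiableOn one_ne_zero).differentiableAt (hU.mem_nhds hu')).hasFDerivAt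
    exact (EuclideanSpace.proj i : Pt →L[ℝ] ℝ).hasFDerivAt.comp u
      (hd.comp u (PiLp.hasFDerivAt_toLp 2 u))
  · refine ContinuousOn.integrableOn_compact isCompact_Icc ?_
    exact (hV.continuousOn_divergence hU).comp hcont.continuousOn (fun u hu => hcU (hmem u hu))

/-- The product rule for the divergence. -/
theorem divergence_smul {φ : Pt → ℝ} {G : Pt → Pt} {x : Pt} (hφ : DifferentiableAt ℝ φ x)
    (hG : DifferentiableAt ℝ G x) :
    divergence (fun x => φ x • G x) x = φ x * divergence G x + fderiv ℝ φ x (G x) := by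
  have hsum : G x = ∑ i, G x i • EuclideanSpace.single i (1 : ℝ) := by
    ext j
    simp [Finset.sum_apply, Pi.single_apply]
  conv_rhs => rw [hsum, map_sum]
  unfold divergence
  rw [fderiv_fun_smul hφ hG, Finset.mul_sum, ← Finset.sum_add_distrib]
  refine Finset.sum_congr rfl fun i _ => ?_
  simp [mul_comm]

theorem divergence_sub_const (z x : Pt) : divergence (fun x => x - z) x = 3 := by
  simp [divergence, fderiv_sub_const]

/-- The regularization `(x - z) / (‖x - z‖² + ε)` of the Hardy vector field centered at `z`. -/
def hardyField (ε : ℝ) (z x : Pt) : Pt := (‖x - z‖ ^ 2 + ε)⁻¹ • (x - z)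

theorem contDiff_hardyField {ε : ℝ} (hε : 0 < ε) (z : Pt) : ContDiff ℝ 1 (hardyField ε z) := by
  have h : ContDiff ℝ 1 fun x : Pt => ‖x - z‖ ^ 2 + ε :=
    ((contDiff_id.sub contDiff_const).norm_sq ℝ).add contDiff_const
  exact (h.inv fun x => by positivity).smul (contDiff_id.sub contDiff_const)

theorem le_divergence_hardyField {ε : ℝ} (hε : 0 < ε) (z x : Pt) :
    (‖x - z‖ ^ 2 + ε)⁻¹ ≤ divergence (hardyField ε z) x := by
  have hpos : 0 < ‖x - z‖ ^ 2 + ε := by positivity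
  have hd : HasFDerivAt (fun x : Pt => ‖x - z‖ ^ 2 + ε) (2 • innerSL ℝ (x - z)) x := by
    simpa using (((hasFDerivAt_id x).sub_const z).norm_sq).add_const ε
  have hi := (hasDerivAt_inv hpos.ne').comp_hasFDerivAt x hd
  have hi' : HasFDerivAt (fun x : Pt => (‖x - z‖ ^ 2 + ε)⁻¹)
    (-((‖x - z‖ ^ 2 + ε) ^ 2)⁻¹ • (2 • innerSL ℝ (x - z))) x := hi
  have h := divergence_smul hi'.differentiableAt
    ((differentiableAt_id (𝕜 := ℝ) (x := x)).sub_const z)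
  simp only [id] at h
  unfold hardyField
  rw [h, hi'.fderiv, divergence_sub_const]
  simp only [two_smul, FunLike.coe_smul, FunLike.coe_add, Pi.smul_apply, Pi.add_apply,
    innerSL_apply_apply, real_inner_self_eq_norm_sq, smul_eq_mul]
  have : (‖x - z‖ ^ 2 + ε)⁻¹ * 3 + -((‖x - z‖ ^ 2 + ε) ^ 2)⁻¹ * (‖x - z‖ ^ 2 + ‖x - z‖ ^ 2)
    = (‖x - z‖ ^ 2 + ε)⁻¹ + 2 * ε * ((‖x - z‖ ^ 2 + ε) ^ 2)⁻¹ := by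
    field_simp
    ring
  rw [this]
  have : 0 ≤ 2 * ε * ((‖x - z‖ ^ 2 + ε) ^ 2)⁻¹ := by positivity
  linarith

theorem norm_hardyField_sq_le {ε : ℝ} (hε : 0 < ε) (z x : Pt) :
    ‖hardyField ε z x‖ ^ 2 ≤ (‖x - z‖ ^ 2 + ε)⁻¹ := by
  have hpos : 0 < ‖x - z‖ ^ 2 + ε := by positivity
  rw [hardyField, norm_smul, mul_pow, norm_inv, Real.norm_of_nonneg hpos.le]
  calc (‖x - z‖ ^ 2 + ε)⁻¹ ^ 2 * ‖x - z‖ ^ 2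
      ≤ (‖x - z‖ ^ 2 + ε)⁻¹ ^ 2 * (‖x - z‖ ^ 2 + ε) := by gcongr; linarith
    _ = (‖x - z‖ ^ 2 + ε)⁻¹ := by field_simp

theorem abs_hardyField_apply_le {ε d : ℝ} (hε : 0 < ε) (hd : 0 < d) {z x : Pt} {i : Fin 3}
    (h : d ≤ |x i - z i|) : |hardyField ε z x i| ≤ 1 / d := by
  have hpos : 0 < ‖x - z‖ ^ 2 + ε := by positivity
  have hc : |x i - z i| ≤ ‖x - z‖ := by
    simpa using PiLp.norm_apply_le (x - z) i
  have : hardyField ε z x i = (‖x - z‖ ^ 2 + ε)⁻¹ * (x i - z i) := by simp [hardyField]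
  rw [this, abs_mul, abs_of_pos (inv_pos.2 hpos), inv_mul_le_iff₀ hpos, mul_one_div,
    le_div_iff₀ hd]
  nlinarith [abs_nonneg (x i - z i)]

/-- The reflections of `y` in the coordinate hyperplanes through `v`. -/
def imagePoint (v y : Pt) (σ : Fin 3 → Bool) : Pt :=
  WithLp.toLp 2 fun i => v i + (if σ i then y i - v i else -(y i - v i))

theorem imagePoint_true (v y : Pt) : imagePoint v y (fun _ => true) = y := by
  ext i
  simp [imagePoint]

theorem norm_sub_imagePoint_flip {v y x : Pt} {i : Fin 3} (hx : x i = v i) (σ : Fin 3 → Bool) :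
    ‖x - imagePoint v y (Function.update σ i (!σ i))‖ = ‖x - imagePoint v y σ‖ := by
  rw [EuclideanSpace.norm_eq, EuclideanSpace.norm_eq]
  congr 1
  refine Finset.sum_congr rfl fun j _ => ?_
  by_cases hj : j = i
  · subst hj
    cases h : σ j <;> simp [imagePoint, hx, h, sub_sq_comm]
  · simp [imagePoint, Function.update_of_ne hj]

/-- The sum of the Hardy fields centered at the reflections of `y`, corrected so that it does not
point outwards on the faces of the cube not containing the vertex `v`. -/
def reflectedField (ε ℓ : ℝ) (v y x : Pt) : Pt :=
  ∑ σ, hardyField ε (imagePoint v y σ) x - (16 / ℓ ^ 2) • (x - v)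

theorem contDiff_reflectedField {ε : ℝ} (hε : 0 < ε) (ℓ : ℝ) (v y : Pt) :
    ContDiff ℝ 1 (reflectedField ε ℓ v y) :=
  (ContDiff.sum fun _ _ => contDiff_hardyField hε _).sub
    ((contDiff_id.sub contDiff_const).const_smul _)

theorem sum_hardyField_apply_eq_zero {ε : ℝ} {v y x : Pt} {i : Fin 3} (hx : x i = v i) :
    ∑ σ, hardyField ε (imagePoint v y σ) x i = 0 := by
  refine Finset.sum_involution (fun σ _ => Function.update σ i (!σ i)) ?_ ?_ ?_ ?_
  · intro σ _
    have h : ∀ τ, hardyField ε (imagePoint v y τ) x i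
        = (‖x - imagePoint v y τ‖ ^ 2 + ε)⁻¹ * (x i - imagePoint v y τ i) := by
      simp [hardyField]
    rw [h, h, norm_sub_imagePoint_flip hx, ← mul_add]
    cases hσ : σ i <;> simp [imagePoint, hx, hσ]
  · intro σ _ _ h
    have := congrFun h i
    simp at this
  · simp
  · intro σ _
    simp

theorem abs_sum_hardyField_apply_le {ε ℓ : ℝ} (hε : 0 < ε) (hℓ : 0 < ℓ) {v y x : Pt} {i : Fin 3}
    (hx : |x i - v i| = ℓ) (hy : |y i - v i| ≤ ℓ / 2) :
    |∑ σ, hardyField ε (imagePoint v y σ) x i| ≤ 16 / ℓ := by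
  refine (Finset.abs_sum_le_sum_abs _ _).trans ?_
  have h : ∀ σ, |hardyField ε (imagePoint v y σ) x i| ≤ 1 / (ℓ / 2) := by
    intro σ
    refine abs_hardyField_apply_le hε (by positivity) ?_
    have h1 : |imagePoint v y σ i - v i| ≤ ℓ / 2 := by
      cases hσ : σ i
      · simpa [imagePoint, hσ, abs_sub_comm] using hy
      · simpa [imagePoint, hσ] using hy
    have h2 := abs_sub_abs_le_abs_sub (x i - v i) (imagePoint v y σ i - v i)
    rw [sub_sub_sub_cancel_right] at h2
    linarith
  refine (Finset.sum_le_sum fun σ _ => h σ).trans (le_of_eq ?_)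
  simp
  ring

theorem reflectedField_apply (ε ℓ : ℝ) (v y x : Pt) (i : Fin 3) :
    reflectedField ε ℓ v y x i
      = ∑ σ, hardyField ε (imagePoint v y σ) x i - 16 / ℓ ^ 2 * (x i - v i) := by
  simp [reflectedField]

theorem reflectedField_upper {ε ℓ : ℝ} (hε : 0 < ε) (hℓ : 0 < ℓ) {v y x : Pt} {i : Fin 3}
    (hv : v i = 0 ∨ v i = ℓ) (hy : |y i - v i| ≤ ℓ / 2) (hx : x i = ℓ) :
    reflectedField ε ℓ v y x i ≤ 0 := by
  rw [reflectedField_apply]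
  rcases hv with hv | hv
  · have h := (abs_le.1 (abs_sum_hardyField_apply_le (x := x) hε hℓ
      (by rw [hx, hv, sub_zero, abs_of_pos hℓ]) hy)).2
    have : 16 / ℓ ^ 2 * (x i - v i) = 16 / ℓ := by
      rw [hx, hv]
      field_simp
      ring
    linarith
  · rw [sum_hardyField_apply_eq_zero (hx.trans hv.symm), hx, hv]
    simp

theorem reflectedField_lower {ε ℓ : ℝ} (hε : 0 < ε) (hℓ : 0 < ℓ) {v y x : Pt} {i : Fin 3}
    (hv : v i = 0 ∨ v i = ℓ) (hy : |y i - v i| ≤ ℓ / 2) (hx : x i = 0) :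
    0 ≤ reflectedField ε ℓ v y x i := by
  rw [reflectedField_apply]
  rcases hv with hv | hv
  · rw [sum_hardyField_apply_eq_zero (hx.trans hv.symm), hx, hv]
    simp
  · have h := (abs_le.1 (abs_sum_hardyField_apply_le (x := x) hε hℓ
      (by rw [hx, hv, zero_sub, abs_neg, abs_of_pos hℓ]) hy)).1
    have : 16 / ℓ ^ 2 * (x i - v i) = -(16 / ℓ) := by
      rw [hx, hv]
      field_simp
      ring
    linarith

theorem le_divergence_reflectedField {ε : ℝ} (hε : 0 < ε) (ℓ : ℝ) (v y x : Pt) :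
    ∑ σ, (‖x - imagePoint v y σ‖ ^ 2 + ε)⁻¹ - 48 / ℓ ^ 2
      ≤ divergence (reflectedField ε ℓ v y) x := by
  have hF : ∀ σ, DifferentiableAt ℝ (hardyField ε (imagePoint v y σ)) x := fun σ =>
    ((contDiff_hardyField hε _).differentiable one_ne_zero) x
  have hd : HasFDerivAt (reflectedField ε ℓ v y)
      (∑ σ, fderiv ℝ (hardyField ε (imagePoint v y σ)) x
        - (16 / ℓ ^ 2) • ContinuousLinearMap.id ℝ Pt) x :=
    (HasFDerivAt.fun_sum fun σ _ => (hF σ).hasFDerivAt).sub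
      (((hasFDerivAt_id x).sub_const v).const_smul (16 / ℓ ^ 2))
  have h : divergence (reflectedField ε ℓ v y) x
      = ∑ σ, divergence (hardyField ε (imagePoint v y σ)) x - 48 / ℓ ^ 2 := by
    unfold divergence
    rw [hd.fderiv, Finset.sum_comm]
    simp [Finset.sum_apply]
    ring
  rw [h]
  exact sub_le_sub_right (Finset.sum_le_sum fun σ _ => le_divergence_hardyField hε _ _) _

theorem inner_apply_ge {g : ℂ} {L : Pt →L[ℝ] ℂ} {u : Pt} {a W : ℝ} (ha : 0 < a)
    (hu : ‖u‖ ^ 2 ≤ W) : -(a * ‖L‖ ^ 2 + W / a * ‖g‖ ^ 2) ≤ 2 * inner ℝ g (L u) := by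
  have h1 : |inner ℝ g (L u)| ≤ ‖g‖ * (‖L‖ * ‖u‖) :=
    (abs_real_inner_le_norm _ _).trans (by gcongr; exact L.le_opNorm u)
  have h2 : W / a * ‖g‖ ^ 2 ≥ ‖u‖ ^ 2 / a * ‖g‖ ^ 2 := by gcongr
  have h3 : a * ‖L‖ ^ 2 + ‖u‖ ^ 2 / a * ‖g‖ ^ 2 - 2 * (‖g‖ * (‖L‖ * ‖u‖))
      = (a * ‖L‖ - ‖u‖ * ‖g‖) ^ 2 / a := by
    field_simp
    ring
  have h4 : 0 ≤ (a * ‖L‖ - ‖u‖ * ‖g‖) ^ 2 / a := by positivity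
  linarith [(abs_le.1 h1).1]

theorem norm_sub_vertex_sq_le {ℓ : ℝ} {v x : Pt} (hv : ∀ i, v i = 0 ∨ v i = ℓ)
    (hx : x ∈ cube ℓ) : ‖x - v‖ ^ 2 ≤ 3 * ℓ ^ 2 := by
  rw [EuclideanSpace.real_norm_sq_eq]
  have h : ∀ i ∈ Finset.univ, (x - v) i ^ 2 ≤ ℓ ^ 2 := by
    intro i _
    obtain ⟨h0, h1⟩ := hx i
    rw [PiLp.sub_apply]
    rcases hv i with h | h <;> rw [h] <;> nlinarith
  simpa using Finset.sum_le_sum h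

/-- The pointwise lower bound for the divergence of `‖f‖²` times the reflected field. -/
theorem le_divergence_normSq_smul_reflectedField {ε ℓ : ℝ} (hε : 0 < ε) (hℓ : 0 < ℓ)
    {v y x : Pt} (hv : ∀ i, v i = 0 ∨ v i = ℓ) (hx : x ∈ cube ℓ) {f : Pt → ℂ}
    (hf : DifferentiableAt ℝ f x) :
    1 / 2 * (‖f x‖ ^ 2 / (‖x - y‖ ^ 2 + ε)) - 32 * ‖fderiv ℝ f x‖ ^ 2
        - 96 / ℓ ^ 2 * ‖f x‖ ^ 2
      ≤ divergence (fun x => ‖f x‖ ^ 2 • reflectedField ε ℓ v y x) x := by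
  have hd := hf.hasFDerivAt.norm_sq
  rw [divergence_smul hd.differentiableAt
    ((contDiff_reflectedField hε ℓ v y).differentiable one_ne_zero x), hd.fderiv]
  set w : (Fin 3 → Bool) → ℝ := fun σ => (‖x - imagePoint v y σ‖ ^ 2 + ε)⁻¹ with hw
  have hw0 : ∀ σ, 0 ≤ w σ := fun σ => by positivity
  have hdiv : ‖f x‖ ^ 2 * (∑ σ, w σ - 48 / ℓ ^ 2)
      ≤ ‖f x‖ ^ 2 * divergence (reflectedField ε ℓ v y) x := by
    gcongr
    exact le_divergence_reflectedField hε ℓ v y x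
  have hsingle : ‖f x‖ ^ 2 / (‖x - y‖ ^ 2 + ε) ≤ ‖f x‖ ^ 2 * ∑ σ, w σ := by
    rw [div_eq_mul_inv]
    gcongr
    have := Finset.single_le_sum (fun σ _ => hw0 σ) (Finset.mem_univ fun _ : Fin 3 => true)
    simpa only [hw, imagePoint_true] using this
  have hF : -(16 * ‖fderiv ℝ f x‖ ^ 2 + 1 / 2 * (‖f x‖ ^ 2 * ∑ σ, w σ))
      ≤ ∑ σ, 2 * inner ℝ (f x) (fderiv ℝ f x (hardyField ε (imagePoint v y σ) x)) := by
    have := Finset.sum_le_sum fun σ (_ : σ ∈ Finset.univ) =>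
      inner_apply_ge (g := f x) (L := fderiv ℝ f x) two_pos
        (norm_hardyField_sq_le hε (imagePoint v y σ) x)
    refine le_trans (le_of_eq ?_) this
    rw [Finset.sum_neg_distrib, Finset.sum_add_distrib, ← Finset.sum_mul (f := fun σ => w σ / 2),
      ← Finset.sum_div]
    simp [hw]
    ring
  have hu : ‖(-(16 / ℓ ^ 2)) • (x - v)‖ ^ 2 ≤ 768 / ℓ ^ 2 := by
    rw [norm_smul, mul_pow, norm_neg, Real.norm_of_nonneg (by positivity)]
    calc (16 / ℓ ^ 2) ^ 2 * ‖x - v‖ ^ 2 ≤ (16 / ℓ ^ 2) ^ 2 * (3 * ℓ ^ 2) := by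
          gcongr
          exact norm_sub_vertex_sq_le hv hx
      _ = 768 / ℓ ^ 2 := by field_simp; norm_num
  have hH := inner_apply_ge (g := f x) (L := fderiv ℝ f x) (a := 16) (by norm_num) hu
  have hsplit : (2 • (innerSL ℝ (f x)).comp (fderiv ℝ f x)) (reflectedField ε ℓ v y x)
      = ∑ σ, 2 * inner ℝ (f x) (fderiv ℝ f x (hardyField ε (imagePoint v y σ) x))
        + 2 * inner ℝ (f x) (fderiv ℝ f x ((-(16 / ℓ ^ 2)) • (x - v))) := by
    rw [← Finset.mul_sum, ← inner_sum, ← map_sum, ← mul_add, ← inner_add_right, ← map_add,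
      neg_smul, ← sub_eq_add_neg, two_mul]
    simp only [two_smul, FunLike.coe_add, Pi.add_apply, ContinuousLinearMap.comp_apply,
      innerSL_apply_apply, reflectedField]
  rw [hsplit]
  have hconst : 768 / ℓ ^ 2 / 16 * ‖f x‖ ^ 2 = 48 / ℓ ^ 2 * ‖f x‖ ^ 2 := by ring
  have hconst' : 96 / ℓ ^ 2 * ‖f x‖ ^ 2 = 2 * (48 / ℓ ^ 2 * ‖f x‖ ^ 2) := by ring
  rw [hconst] at hH
  rw [mul_sub] at hdiv
  rw [hconst']
  linarith [mul_comm (‖f x‖ ^ 2) (48 / ℓ ^ 2)]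

/-- The regularized Hardy inequality with the singularity in the cube. -/
theorem regularized_hardy_of_mem {ε ℓ : ℝ} (hε : 0 < ε) (hℓ : 0 < ℓ) {y : Pt} (hy : y ∈ cube ℓ)
    {f : Pt → ℂ} {U : Set Pt} (hU : IsOpen U) (hcU : cube ℓ ⊆ U) (hf : ContDiffOn ℝ 1 f U) :
    (1 / 4) * ∫ x in cube ℓ, ‖f x‖ ^ 2 / (‖x - y‖ ^ 2 + ε)
      ≤ 16 * (∫ x in cube ℓ, ‖fderiv ℝ f x‖ ^ 2)
        + (48 / ℓ ^ 2) * ∫ x in cube ℓ, ‖f x‖ ^ 2 := by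
  have hv : ∀ i, ∃ t : ℝ, (t = 0 ∨ t = ℓ) ∧ |y i - t| ≤ ℓ / 2 := by
    intro i
    obtain ⟨h0, h1⟩ := hy i
    rcases le_total (y i) (ℓ / 2) with h | h
    · exact ⟨0, Or.inl rfl, abs_le.2 ⟨by linarith, by linarith⟩⟩
    · exact ⟨ℓ, Or.inr rfl, abs_le.2 ⟨by linarith, by linarith⟩⟩
  choose t ht hyt using hv
  set v : Pt := WithLp.toLp 2 t
  have hV : ContDiffOn ℝ 1 (fun x => ‖f x‖ ^ 2 • reflectedField ε ℓ v y x) U :=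
    (hf.norm_sq ℝ).smul (contDiff_reflectedField hε ℓ v y).contDiffOn
  have hnonpos := setIntegral_divergence_cube_nonpos hℓ hU hcU hV
    (fun x _ i hi => mul_nonpos_of_nonneg_of_nonpos (by positivity)
      (reflectedField_upper hε hℓ (ht i) (hyt i) hi))
    (fun x _ i hi => mul_nonneg (by positivity)
      (reflectedField_lower hε hℓ (ht i) (hyt i) hi))
  have hK := isCompact_cube ℓ
  have hfc : ContinuousOn f (cube ℓ) := hf.continuousOn.mono hcU
  have hf'c : ContinuousOn (fderiv ℝ f) (cube ℓ) :=
    (hf.continuousOn_fderiv_of_isOpen hU le_rfl).mono hcU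
  have i1 : IntegrableOn (fun x => ‖f x‖ ^ 2 / (‖x - y‖ ^ 2 + ε)) (cube ℓ) :=
    ContinuousOn.integrableOn_compact hK
      ((hfc.norm.pow 2).div (by fun_prop) fun x _ => by positivity)
  have i2 : IntegrableOn (fun x => ‖fderiv ℝ f x‖ ^ 2) (cube ℓ) :=
    ContinuousOn.integrableOn_compact hK (hf'c.norm.pow 2)
  have i3 : IntegrableOn (fun x => ‖f x‖ ^ 2) (cube ℓ) :=
    ContinuousOn.integrableOn_compact hK (hfc.norm.pow 2)
  have i4 : IntegrableOn (divergence fun x => ‖f x‖ ^ 2 • reflectedField ε ℓ v y x) (cube ℓ) :=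
    ContinuousOn.integrableOn_compact hK ((hV.continuousOn_divergence hU).mono hcU)
  have hmono := setIntegral_mono_on
    (((i1.const_mul (1 / 2)).sub (i2.const_mul 32)).sub (i3.const_mul (96 / ℓ ^ 2))) i4
    hK.measurableSet fun x hx => le_divergence_normSq_smul_reflectedField hε hℓ ht hx
      ((hf.differentiableOn one_ne_zero).differentiableAt (hU.mem_nhds (hcU hx)))
  have heq := integral_sub ((i1.const_mul (1 / 2)).sub (i2.const_mul 32))
    (i3.const_mul (96 / ℓ ^ 2))
  have heq' := integral_sub (i1.const_mul (1 / 2)) (i2.const_mul 32)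
  simp only [Pi.sub_apply, integral_const_mul] at heq heq' hmono
  rw [heq, heq'] at hmono
  have : 96 / ℓ ^ 2 * ∫ x in cube ℓ, ‖f x‖ ^ 2 = 2 * (48 / ℓ ^ 2 * ∫ x in cube ℓ, ‖f x‖ ^ 2) := by
    ring
  linarith

/-- The coordinatewise projection of `y` onto the cube is closer to every point of the cube. -/
theorem exists_mem_cube_norm_sub_le {ℓ : ℝ} (hℓ : 0 < ℓ) (y : Pt) :
    ∃ z ∈ cube ℓ, ∀ x ∈ cube ℓ, ‖x - z‖ ≤ ‖x - y‖ := by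
  refine ⟨WithLp.toLp 2 fun i => max 0 (min ℓ (y i)), fun i => ?_, fun x hx => ?_⟩
  · exact ⟨le_max_left _ _, max_le hℓ.le (min_le_left _ _)⟩
  · rw [EuclideanSpace.norm_eq, EuclideanSpace.norm_eq]
    refine Real.sqrt_le_sqrt (Finset.sum_le_sum fun i _ => ?_)
    gcongr
    obtain ⟨h0, h1⟩ := hx i
    have h : |x i - max 0 (min ℓ (y i))| ≤ |x i - y i| := by
      have hxi : x i = max 0 (min ℓ (x i)) := by rw [min_eq_right h1, max_eq_right h0]
      conv_lhs => rw [hxi]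
      rw [max_comm 0, max_comm 0]
      refine (abs_max_sub_max_le_abs _ _ _).trans ?_
      simpa using abs_min_sub_min_le_max ℓ (x i) ℓ (y i)
    simpa using h

theorem regularized_hardy {ε ℓ : ℝ} (hε : 0 < ε) (hℓ : 0 < ℓ) (y : Pt)
    {f : Pt → ℂ} {U : Set Pt} (hU : IsOpen U) (hcU : cube ℓ ⊆ U) (hf : ContDiffOn ℝ 1 f U) :
    (1 / 4) * ∫ x in cube ℓ, ‖f x‖ ^ 2 / (‖x - y‖ ^ 2 + ε)
      ≤ 16 * (∫ x in cube ℓ, ‖fderiv ℝ f x‖ ^ 2)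
        + (48 / ℓ ^ 2) * ∫ x in cube ℓ, ‖f x‖ ^ 2 := by
  obtain ⟨z, hz, hzy⟩ := exists_mem_cube_norm_sub_le hℓ y
  refine le_trans ?_ (regularized_hardy_of_mem hε hℓ hz hU hcU hf)
  have hint : ∀ p : Pt, IntegrableOn (fun x => ‖f x‖ ^ 2 / (‖x - p‖ ^ 2 + ε)) (cube ℓ) :=
    fun p => ContinuousOn.integrableOn_compact (isCompact_cube ℓ)
      (((hf.continuousOn.mono hcU).norm.pow 2).div (by fun_prop) fun x _ => by positivity)
  refine mul_le_mul_of_nonneg_left ?_ (by norm_num)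
  refine setIntegral_mono_on (hint y) (hint z) (isCompact_cube ℓ).measurableSet fun x hx => ?_
  have := hzy x hx
  gcongr

/-- **Local Hardy inequality on a cube, with arbitrary location of the singularity.**
For `f ∈ H¹(C_ℓ)` (it suffices to consider `f` continuously differentiable on a
neighborhood of the cube) and any `y ∈ ℝ³`,
`16∫_{C_ℓ}|∇f|² + (144/ℓ²)∫_{C_ℓ}|f|² ≥ (1/4)∫_{C_ℓ}|f|²/|x-y|²`. -/
theorem hardy_inequality_cube (ℓ : ℝ) (hℓ : 0 < ℓ) (y : Pt) (f : Pt → ℂ)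
    (hf : ∃ U : Set Pt, IsOpen U ∧ cube ℓ ⊆ U ∧ ContDiffOn ℝ 1 f U) :
    (1/4) * ∫ x in cube ℓ, ‖f x‖^2 / ‖x - y‖^2
      ≤ 16 * (∫ x in cube ℓ, ‖fderiv ℝ f x‖^2)
        + (144 / ℓ^2) * ∫ x in cube ℓ, ‖f x‖^2 := by
  obtain ⟨U, hU, hcU, hf⟩ := hf
  have hL2 : 0 ≤ ∫ x in cube ℓ, ‖f x‖ ^ 2 := integral_nonneg fun x => by positivity
  have hgrad : 0 ≤ ∫ x in cube ℓ, ‖fderiv ℝ f x‖ ^ 2 := integral_nonneg fun x => by positivity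
  have hconst : (48 / ℓ ^ 2) * ∫ x in cube ℓ, ‖f x‖ ^ 2
      ≤ (144 / ℓ ^ 2) * ∫ x in cube ℓ, ‖f x‖ ^ 2 := by gcongr; norm_num
  by_cases hint : IntegrableOn (fun x => ‖f x‖ ^ 2 / ‖x - y‖ ^ 2) (cube ℓ)
  · refine le_trans ?_ (add_le_add_right hconst _)
    have hlim : Filter.Tendsto (fun ε : ℝ => ∫ x in cube ℓ, ‖f x‖ ^ 2 / (‖x - y‖ ^ 2 + ε))
        (nhdsWithin 0 (Set.Ioi 0)) (nhds (∫ x in cube ℓ, ‖f x‖ ^ 2 / ‖x - y‖ ^ 2)) := by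
      have hae : ∀ᵐ x ∂(volume.restrict (cube ℓ)), x ≠ y :=
        ae_restrict_of_ae (Measure.ae_ne volume y)
      refine tendsto_integral_filter_of_dominated_convergence _ ?_ ?_ hint ?_
      · filter_upwards [self_mem_nhdsWithin] with ε hε
        have hε' : 0 < ε := hε
        exact (ContinuousOn.integrableOn_compact (isCompact_cube ℓ)
          (((hf.continuousOn.mono hcU).norm.pow 2).div (by fun_prop)
            fun x _ => by positivity)).aestronglyMeasurable
      · filter_upwards [self_mem_nhdsWithin] with ε hε
        have hε' : 0 < ε := hε
        filter_upwards [hae] with x hx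
        have hpos : 0 < ‖x - y‖ := norm_pos_iff.2 (sub_ne_zero.2 hx)
        rw [Real.norm_of_nonneg (by positivity)]
        gcongr
        linarith
      · filter_upwards [hae] with x hx
        have hpos : 0 < ‖x - y‖ := norm_pos_iff.2 (sub_ne_zero.2 hx)
        have hc : ContinuousAt (fun ε : ℝ => ‖f x‖ ^ 2 / (‖x - y‖ ^ 2 + ε)) 0 :=
          continuousAt_const.div (by fun_prop) (by positivity)
        simpa using hc.tendsto.mono_left nhdsWithin_le_nhds
    refine le_of_tendsto (hlim.const_mul (1 / 4)) ?_
    filter_upwards [self_mem_nhdsWithin] with ε hε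
    exact regularized_hardy hε hℓ y hU hcU hf
  · rw [integral_undef hint]
    rw [mul_zero]
    positivity
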